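/- Let k >= 1 be an integer, ell an integer with 0 <= ell <= k, and L, M nonnegative integers with L + M + ell even; let q be real with 0 < q < 1. Then sum_{i = 0, i == L (mod 2)}^{k} X^{(1,k+2)}_{1,i+1}(M, ell+1; q^{-1}) * X^{(1,k+2)}_{1,i+1}(L, 1; q) = q^{(L^2 - (M+ell)^2)/(4k) - (L-M-ell)/2} * sum_n q^{n C^{-1}(n - M e_1 - e_ell)} prod_{i=1}^{k-1} [n_i+m_i choose n_i]_q, where the sum is over all n = (n_1,...,n_{k-1}) in Z^{k-1} satisfying L + M + ell == 2*sum_{i=1}^{k-1} i n_i (mod 2k) (equivalently (L+M+ell)/(2k) + (C^{-1}n)_1 is an integer), m = C^{-1}[(L+M) e_1 + e_ell - 2n] (whose entries are integers under the congruence), and only finitely many terms of the sum are nonzero. -/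

import Mathlib

open scoped BigOperators

noncomputable section

/-- Finite q-Pochhammer symbol `(a;q)_n`. -/
def qP (q a : ℝ) (n : ℕ) : ℝ := ∏ m ∈ Finset.range n, (1 - a * q ^ m)

/-- q-binomial coefficient `[n choose m]_q`, zero unless `0 ≤ m ≤ n`. -/
def qBinI (q : ℝ) (n m : ℤ) : ℝ :=
  if 0 ≤ m ∧ m ≤ n then
    qP q q n.toNat * ((qP q q m.toNat)⁻¹ * (qP q q (n - m).toNat)⁻¹)
  else 0

/-- One-dimensional configuration sum `X^{(p,p')}_{r,s}(L,b;q)` of the ABF model. -/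
def Xcfg (q : ℝ) (p p' r s b L : ℤ) : ℝ :=
  ∑' j : ℤ,
    (q ^ (j * (p * p' * j + p' * r - p * s)) * qBinI q L ((L + s - b) / 2 - p' * j)
      - q ^ ((p * j + r) * (p' * j + s)) * qBinI q L ((L - s - b) / 2 - p' * j))

/-- Entry `(C⁻¹)_{i+1,j+1}` of the inverse A_{k-1} Cartan matrix (0-based indices). -/
def cinv (k i j : ℕ) : ℚ :=
  (min (i + 1) (j + 1) : ℚ) - (((i : ℚ) + 1) * ((j : ℚ) + 1)) / (k : ℚ)

/-- Quadratic form `w C⁻¹ v`. -/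
def quad (k : ℕ) (w v : Fin (k - 1) → ℤ) : ℚ :=
  ∑ i : Fin (k - 1), ∑ j : Fin (k - 1), (w i : ℚ) * cinv k (i : ℕ) (j : ℕ) * (v j : ℚ)

/-- `i`-th entry of `C⁻¹ v`. -/
def mvec (k : ℕ) (v : Fin (k - 1) → ℤ) (i : Fin (k - 1)) : ℚ :=
  ∑ j : Fin (k - 1), cinv k (i : ℕ) (j : ℕ) * (v j : ℚ)

/-- The unit vector `e_l` of `ℤ^{k-1}` (1-based label; `e_0 = e_k = 0`). -/
def eV (k : ℕ) (l : ℤ) : Fin (k - 1) → ℤ := fun i => if (i : ℤ) + 1 = l then 1 else 0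

/-- q-binomial coefficient with rational arguments: it is
`(q;q)_a / ((q;q)_b (q;q)_{a-b})` when `a, b` are integers with `0 ≤ b ≤ a`, and `0` otherwise. -/
def qBinQ (q : ℝ) (a b : ℚ) : ℝ :=
  if a.den = 1 ∧ b.den = 1 ∧ 0 ≤ b ∧ b ≤ a then
    qP q q a.num.toNat * ((qP q q b.num.toNat)⁻¹ * (qP q q (a.num - b.num).toNat)⁻¹)
  else 0


/-! ### q-binomials -/

theorem qP_zero (q a : ℝ) : qP q a 0 = 1 := by simp [qP]

theorem qP_succ (q : ℝ) (n : ℕ) : qP q q (n + 1) = qP q q n * (1 - q ^ (n + 1)) := by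
  simp only [qP, Finset.prod_range_succ, pow_succ']

theorem one_sub_pow_ne {q : ℝ} (h0 : 0 < q) (h1 : q ≠ 1) (n : ℕ) : 1 - q ^ (n + 1) ≠ 0 := by
  intro h
  have : q ^ (n + 1) = 1 := by linarith
  rw [pow_eq_one_iff_of_nonneg h0.le (by omega)] at this
  exact h1 this

theorem qP_ne {q : ℝ} (h0 : 0 < q) (h1 : q ≠ 1) (n : ℕ) : qP q q n ≠ 0 := by
  induction n with
  | zero => simp [qP_zero]
  | succ n ih => rw [qP_succ]; exact mul_ne_zero ih (one_sub_pow_ne h0 h1 n)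

theorem qBinI_nat (q : ℝ) (a b : ℕ) :
    qBinI q ((a : ℤ) + b) a = qP q q (a + b) * ((qP q q a)⁻¹ * (qP q q b)⁻¹) := by
  unfold qBinI
  rw [if_pos (by omega)]
  have h1 : ((a : ℤ) + b).toNat = a + b := by omega
  have h2 : ((a : ℤ) + b - a).toNat = b := by omega
  rw [h1, h2, Int.toNat_natCast]

theorem qBinI_out (q : ℝ) {n m : ℤ} (h : ¬ (0 ≤ m ∧ m ≤ n)) : qBinI q n m = 0 := by
  unfold qBinI; rw [if_neg h]

theorem qBinI_ne (q : ℝ) {n m : ℤ} (h : qBinI q n m ≠ 0) : 0 ≤ m ∧ m ≤ n := by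
  by_contra h'; exact h (qBinI_out q h')

theorem qBinI_zero {q : ℝ} (h0 : 0 < q) (h1 : q ≠ 1) {n : ℤ} (h : 0 ≤ n) : qBinI q n 0 = 1 := by
  lift n to ℕ using h
  have := qBinI_nat q 0 n
  simp only [Nat.cast_zero, zero_add, qP_zero] at this
  rw [this]
  field_simp [qP_ne h0 h1 n]

theorem qBinI_self {q : ℝ} (h0 : 0 < q) (h1 : q ≠ 1) {n : ℤ} (h : 0 ≤ n) : qBinI q n n = 1 := by
  lift n to ℕ using h
  have := qBinI_nat q n 0
  simp only [Nat.cast_zero, add_zero, qP_zero] at this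
  rw [this]
  field_simp [qP_ne h0 h1 n]

theorem qBinI_symm (q : ℝ) (n m : ℤ) : qBinI q n (n - m) = qBinI q n m := by
  unfold qBinI
  by_cases h : 0 ≤ m ∧ m ≤ n
  · rw [if_pos h, if_pos (by omega)]
    rw [sub_sub_cancel]; ring
  · rw [if_neg h, if_neg (by omega)]

/-- `[n,m] = q^m [n-1,m] + [n-1,m-1]` -/
theorem qBinI_pascal {q : ℝ} (h0 : 0 < q) (h1 : q ≠ 1) (n m : ℤ) (h : n ≠ 0 ∨ m ≠ 0) :
    qBinI q n m = q ^ m * qBinI q (n - 1) m + qBinI q (n - 1) (m - 1) := by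
  by_cases hr : 0 ≤ m ∧ m ≤ n
  · obtain ⟨hm, hmn⟩ := hr
    rcases hm.eq_or_lt with rfl | hm
    · rw [qBinI_zero h0 h1 hmn, qBinI_zero h0 h1 (by omega), qBinI_out q (by omega)]; simp
    rcases hmn.eq_or_lt with rfl | hmn
    · rw [qBinI_self h0 h1 hm.le, qBinI_self h0 h1 (by omega), qBinI_out q (by omega)]; simp
    obtain ⟨a, rfl⟩ : ∃ a : ℕ, m = a + 1 := ⟨(m - 1).toNat, by omega⟩
    obtain ⟨b, rfl⟩ : ∃ b : ℕ, n = a + 1 + (b + 1) := ⟨(n - a - 2).toNat, by omega⟩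
    have e1 := qBinI_nat q (a + 1) (b + 1)
    have e2 := qBinI_nat q (a + 1) b
    have e3 := qBinI_nat q a (b + 1)
    push_cast at e1 e2 e3
    have g2 : (a : ℤ) + 1 + (b + 1) - 1 = a + 1 + b := by ring
    have g3 : (a : ℤ) + 1 + b = a + (b + 1) := by ring
    have g4 : (a : ℤ) + 1 - 1 = a := by ring
    rw [g2, g4, e1, e2, g3, e3]
    have z : (q : ℝ) ^ ((a : ℤ) + 1) = q ^ (a + 1) := by exact_mod_cast rfl
    rw [z]
    have k1 : a + 1 + (b + 1) = (a + b + 1) + 1 := by ring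
    have k2 : a + 1 + b = a + b + 1 := by ring
    have k3 : a + (b + 1) = a + b + 1 := by ring
    rw [k1, k2, k3, qP_succ q (a + b + 1), qP_succ q a, qP_succ q b]
    have := qP_ne h0 h1 a
    have := qP_ne h0 h1 b
    have := one_sub_pow_ne h0 h1 a
    have := one_sub_pow_ne h0 h1 b
    field_simp
    ring
  · rw [qBinI_out q hr]
    by_cases h2 : 0 ≤ m ∧ m ≤ n - 1
    · omega
    rw [qBinI_out q h2]
    by_cases h3 : 0 ≤ m - 1 ∧ m - 1 ≤ n - 1
    · omega
    rw [qBinI_out q h3]; simp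

theorem qBinI_pascal' {q : ℝ} (h0 : 0 < q) (h1 : q ≠ 1) (n m : ℤ) (h : n ≠ 0 ∨ m ≠ 0) :
    qBinI q n m = qBinI q (n - 1) m + q ^ (n - m) * qBinI q (n - 1) (m - 1) := by
  have := qBinI_pascal h0 h1 n (n - m) (by omega)
  rw [qBinI_symm] at this
  rw [this, add_comm]
  congr 1
  · rw [← qBinI_symm]; congr 1; ring
  · rw [← qBinI_symm]; congr 2; ring

theorem qBinI_three {q : ℝ} (h0 : 0 < q) (h1 : q ≠ 1) (n m : ℤ) (h : 1 ≤ n) :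
    qBinI q n m = qBinI q (n - 1) m + qBinI q (n - 1) (m - 1)
      + (q ^ (n - 1) - 1) * qBinI q (n - 2) (m - 1) := by
  rw [qBinI_pascal' h0 h1 n m (by omega)]
  by_cases hd : n = 1 ∧ m = 1
  · obtain ⟨rfl, rfl⟩ := hd; simp
  have a1 := qBinI_pascal h0 h1 (n - 1) (m - 1) (by omega)
  have a2 := qBinI_pascal' h0 h1 (n - 1) (m - 1) (by omega)
  have e1 : n - 1 - 1 = n - 2 := by ring
  have e2 : n - 1 - (m - 1) = n - m := by ring
  rw [e1] at a1 a2
  rw [e2] at a2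
  have z : q ^ (n - 1) = q ^ (n - m) * q ^ (m - 1) := by
    rw [← zpow_add₀ h0.ne']; congr 1; ring
  rw [z]
  linear_combination q ^ (n - m) * a1 - a2

theorem qP_inv {q : ℝ} (h0 : 0 < q) (n : ℕ) :
    qP q⁻¹ q⁻¹ n * q ^ (n * (n + 1) / 2) = (-1) ^ n * qP q q n := by
  induction n with
  | zero => simp [qP_zero]
  | succ n ih =>
    have e : (n + 1) * (n + 1 + 1) / 2 = n * (n + 1) / 2 + (n + 1) := by
      have : (n + 1) * (n + 1 + 1) = n * (n + 1) + (n + 1) * 2 := by ring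
      rw [this, Nat.add_mul_div_right _ _ (by norm_num)]
    rw [e, qP_succ, qP_succ, pow_add, inv_pow]
    have hh : (1 - (q ^ (n + 1))⁻¹) * q ^ (n + 1) = - (1 - q ^ (n + 1)) := by
      have := (pow_pos h0 (n + 1)).ne'
      field_simp
      ring
    calc _ = (qP q⁻¹ q⁻¹ n * q ^ (n * (n + 1) / 2)) * ((1 - (q ^ (n + 1))⁻¹) * q ^ (n + 1)) := by ring
      _ = _ := by rw [ih, hh]; ring

theorem qBinI_inv {q : ℝ} (h0 : 0 < q) (h1 : q ≠ 1) (n m : ℤ) :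
    qBinI q⁻¹ n m = q ^ (-(m * (n - m))) * qBinI q n m := by
  by_cases hr : 0 ≤ m ∧ m ≤ n
  · obtain ⟨hm, hmn⟩ := hr
    obtain ⟨a, rfl⟩ : ∃ a : ℕ, m = a := ⟨m.toNat, by omega⟩
    obtain ⟨b, rfl⟩ : ∃ b : ℕ, n = a + b := ⟨(n - a).toNat, by omega⟩
    rw [qBinI_nat, qBinI_nat]
    have i1 := qP_inv h0 (a + b)
    have i2 := qP_inv h0 a
    have i3 := qP_inv h0 b
    have e : (a + b) * (a + b + 1) / 2 = a * (a + 1) / 2 + b * (b + 1) / 2 + a * b := by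
      obtain ⟨x, hx⟩ := (Nat.even_mul_succ_self a).two_dvd
      obtain ⟨y, hy⟩ := (Nat.even_mul_succ_self b).two_dvd
      have : (a + b) * (a + b + 1) = a * (a + 1) + b * (b + 1) + 2 * (a * b) := by ring
      rw [this]
      omega
    rw [e, pow_add, pow_add] at i1
    have z : (q : ℝ) ^ (-((a : ℤ) * ((a : ℤ) + b - a))) = (q ^ (a * b))⁻¹ := by
      rw [zpow_neg]; congr 1
      rw [add_sub_cancel_left]; exact_mod_cast rfl
    rw [z]
    have n1 := qP_ne h0 h1 a
    have n2 := qP_ne h0 h1 b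
    have m1 := qP_ne (inv_pos.2 h0) (by simpa using h1) a
    have m2 := qP_ne (inv_pos.2 h0) (by simpa using h1) b
    have p1 := (pow_pos h0 (a * b)).ne'
    have p2 := (pow_pos h0 (a * (a + 1) / 2)).ne'
    have p3 := (pow_pos h0 (b * (b + 1) / 2)).ne'
    have s1 : ((-1 : ℝ) ^ a) ≠ 0 := by simp
    have s2 : ((-1 : ℝ) ^ b) ≠ 0 := by simp
    have j1 : qP q⁻¹ q⁻¹ a = (-1) ^ a * qP q q a / q ^ (a * (a + 1) / 2) := by
      rw [← i2]; field_simp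
    have j2 : qP q⁻¹ q⁻¹ b = (-1) ^ b * qP q q b / q ^ (b * (b + 1) / 2) := by
      rw [← i3]; field_simp
    have j3 : qP q⁻¹ q⁻¹ (a + b) = (-1) ^ (a + b) * qP q q (a + b) /
        (q ^ (a * (a + 1) / 2) * q ^ (b * (b + 1) / 2) * q ^ (a * b)) := by
      rw [← i1]; field_simp
    rw [j1, j2, j3, pow_add]
    field_simp
  · rw [qBinI_out _ hr, qBinI_out _ hr]; simp

/-! ### the configuration sums -/

theorem supp_fin (q : ℝ) (u : ℤ → ℝ) {P : ℤ} (hP : 1 ≤ P) (L c : ℤ) :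
    Summable (fun j : ℤ => u j * qBinI q L (c - P * j)) := by
  apply summable_of_hasFiniteSupport
  have : (Set.preimage (fun j : ℤ => c - P * j) (Set.Icc 0 L)).Finite := by
    apply Set.Finite.preimage _ (Set.finite_Icc 0 L)
    intro x _ y _ h
    have h' : P * x = P * y := by simpa using h
    exact mul_left_cancel₀ (by omega) h'
  refine this.subset ?_
  intro j hj
  have := qBinI_ne q (right_ne_zero_of_mul (Function.mem_support.1 hj))
  exact this

theorem Xcfg_eq (q : ℝ) (P : ℤ) (s b L : ℤ) : Xcfg q 1 P 1 s b L =
    ∑' j : ℤ, (q ^ (j * (P * j + P - s)) * qBinI q L ((L + s - b) / 2 - P * j)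
      - q ^ ((j + 1) * (P * j + s)) * qBinI q L ((L - s - b) / 2 - P * j)) := by
  unfold Xcfg; simp only [one_mul, mul_one]

theorem Xsum (q : ℝ) {P : ℤ} (hP : 1 ≤ P) (s b L : ℤ) : Summable (fun j : ℤ =>
    (q ^ (j * (P * j + P - s)) * qBinI q L ((L + s - b) / 2 - P * j)
      - q ^ ((j + 1) * (P * j + s)) * qBinI q L ((L - s - b) / 2 - P * j))) :=
  (supp_fin q _ hP L _).sub (supp_fin q _ hP L _)

theorem X_three {q : ℝ} (h0 : 0 < q) (h1 : q ≠ 1) {P : ℤ} (hP : 1 ≤ P) (s b L : ℤ) (hL : 1 ≤ L) :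
    Xcfg q 1 P 1 s b L = Xcfg q 1 P 1 s (b + 1) (L - 1) + Xcfg q 1 P 1 s (b - 1) (L - 1)
      + (q ^ (L - 1) - 1) * Xcfg q 1 P 1 s b (L - 2) := by
  simp only [Xcfg_eq]
  rw [← tsum_mul_left, ← (Xsum q hP s (b + 1) (L - 1)).tsum_add (Xsum q hP s (b - 1) (L - 1)),
    ← ((Xsum q hP s (b + 1) (L - 1)).add (Xsum q hP s (b - 1) (L - 1))).tsum_add
      ((Xsum q hP s b (L - 2)).mul_left _)]
  congr 1; ext j
  have e1 : (L - 1 + s - (b + 1)) / 2 - P * j = (L + s - b) / 2 - P * j - 1 := by omega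
  have e2 : (L - 1 + s - (b - 1)) / 2 - P * j = (L + s - b) / 2 - P * j := by omega
  have e3 : (L - 2 + s - b) / 2 - P * j = (L + s - b) / 2 - P * j - 1 := by omega
  have f1 : (L - 1 - s - (b + 1)) / 2 - P * j = (L - s - b) / 2 - P * j - 1 := by omega
  have f2 : (L - 1 - s - (b - 1)) / 2 - P * j = (L - s - b) / 2 - P * j := by omega
  have f3 : (L - 2 - s - b) / 2 - P * j = (L - s - b) / 2 - P * j - 1 := by omega
  rw [e1, e2, e3, f1, f2, f3, qBinI_three h0 h1 L _ hL,
    qBinI_three h0 h1 L ((L - s - b) / 2 - P * j) hL]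
  ring

theorem X_low {q : ℝ} (h0 : 0 < q) (h1 : q ≠ 1) {P : ℤ} (hP : 1 ≤ P) (s L : ℤ) (hL : 1 ≤ L)
    (hpar : (2 : ℤ) ∣ L + s - 1) :
    Xcfg q 1 P 1 s 1 L = Xcfg q 1 P 1 s 2 (L - 1) := by
  obtain ⟨u, hu⟩ := hpar
  have key : ∀ j : ℤ,
    (q ^ (j * (P * j + P - s)) * qBinI q L ((L + s - 1) / 2 - P * j)
      - q ^ ((j + 1) * (P * j + s)) * qBinI q L ((L - s - 1) / 2 - P * j))
    = (q ^ (j * (P * j + P - s)) * qBinI q (L - 1) ((L - 1 + s - 2) / 2 - P * j)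
      - q ^ ((j + 1) * (P * j + s)) * qBinI q (L - 1) ((L - 1 - s - 2) / 2 - P * j))
    + (q ^ (P * j ^ 2 - s * j + u) * qBinI q (L - 1) (u - P * j)
      - q ^ (P * (-j) ^ 2 - s * (-j) + u) * qBinI q (L - 1) (u - P * (-j))) := by
    intro j
    have e1 : (L + s - 1) / 2 - P * j = u - P * j := by omega
    have e2 : (L - s - 1) / 2 - P * j = u - s - P * j := by omega
    have e3 : (L - 1 + s - 2) / 2 - P * j = u - P * j - 1 := by omega
    have e4 : (L - 1 - s - 2) / 2 - P * j = u - s - P * j - 1 := by omega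
    have e5 : qBinI q (L - 1) (u - P * (-j)) = qBinI q (L - 1) (u - s - P * j) := by
      rw [← qBinI_symm]; congr 1; linarith
    rw [e1, e2, e3, e4, e5, qBinI_pascal h0 h1 L (u - P * j) (by omega),
      qBinI_pascal h0 h1 L (u - s - P * j) (by omega)]
    have z1 : q ^ (P * j ^ 2 - s * j + u) = q ^ (j * (P * j + P - s)) * q ^ (u - P * j) := by
      rw [← zpow_add₀ h0.ne']; congr 1; ring
    have z2 : q ^ (P * (-j) ^ 2 - s * (-j) + u) =
        q ^ ((j + 1) * (P * j + s)) * q ^ (u - s - P * j) := by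
      rw [← zpow_add₀ h0.ne']; congr 1; ring
    rw [z1, z2]; ring
  have S1 := supp_fin q (fun j : ℤ => q ^ (P * j ^ 2 - s * j + u)) hP (L - 1) u
  have S2 := (Equiv.neg ℤ).summable_iff.2 S1
  have T := (Equiv.neg ℤ).tsum_eq
    (fun j : ℤ => q ^ (P * j ^ 2 - s * j + u) * qBinI q (L - 1) (u - P * j))
  simp only [Xcfg_eq]
  simp only [Function.comp_def, Equiv.neg_apply] at T S2
  rw [tsum_congr key, (Xsum q hP s 2 (L - 1)).tsum_add (S1.sub S2), S1.tsum_sub S2]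
  rw [T]; ring

theorem X_top {q : ℝ} {P : ℤ} (hP : 1 ≤ P) (s L : ℤ)
    (hpar : (2 : ℤ) ∣ L + s - P) : Xcfg q 1 P 1 s P L = 0 := by
  obtain ⟨u, hu⟩ := hpar
  have key : ∀ j : ℤ,
    (q ^ (j * (P * j + P - s)) * qBinI q L ((L + s - P) / 2 - P * j)
      - q ^ ((j + 1) * (P * j + s)) * qBinI q L ((L - s - P) / 2 - P * j))
    = (q ^ (j * (P * j + P - s)) * qBinI q L (u - P * j)
      - q ^ ((-1 - j) * (P * (-1 - j) + P - s)) * qBinI q L (u - P * (-1 - j))) := by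
    intro j
    have e1 : (L + s - P) / 2 - P * j = u - P * j := by omega
    have e2 : (L - s - P) / 2 - P * j = u - s - P * j := by omega
    have e5 : qBinI q L (u - P * (-1 - j)) = qBinI q L (u - s - P * j) := by
      rw [← qBinI_symm]; congr 1; linarith
    have e6 : (-1 - j) * (P * (-1 - j) + P - s) = (j + 1) * (P * j + s) := by ring
    rw [e1, e2, e5, e6]
  have S1 := supp_fin q (fun j : ℤ => q ^ (j * (P * j + P - s))) hP L u
  have S2 := (Equiv.subLeft (-1 : ℤ)).summable_iff.2 S1
  have T := (Equiv.subLeft (-1 : ℤ)).tsum_eq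
    (fun j : ℤ => q ^ (j * (P * j + P - s)) * qBinI q L (u - P * j))
  simp only [Xcfg_eq]
  simp only [Function.comp_def, Equiv.subLeft_apply] at T S2
  rw [tsum_congr key, S1.tsum_sub S2]
  rw [T]; ring

theorem X_zero {q : ℝ} (h0 : 0 < q) (h1 : q ≠ 1) {P : ℤ} (s b : ℤ) (hs : 1 ≤ s) (hsP : s ≤ P - 1)
    (hb : 1 ≤ b) (hbP : b ≤ P - 1) (hpar : (2 : ℤ) ∣ s - b) :
    Xcfg q 1 P 1 s b 0 = if s = b then 1 else 0 := by
  obtain ⟨u, hu⟩ := hpar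
  rw [Xcfg_eq, tsum_eq_single 0]
  · rw [qBinI_out q (m := (0 - s - b) / 2 - P * 0) (by omega)]
    split_ifs with h
    · have : (0 + s - b) / 2 - P * 0 = 0 := by omega
      rw [this, qBinI_zero h0 h1 le_rfl]; simp
    · rw [qBinI_out q (by omega)]; simp
  · intro j hj
    have hc : P ≤ P * j ∨ P * j ≤ -P := by
      rcases lt_or_gt_of_ne hj with h | h
      · right; nlinarith
      · left; nlinarith
    rw [qBinI_out q (by omega), qBinI_out q (by omega)]; simp

theorem X_one {q : ℝ} (h0 : 0 < q) (h1 : q ≠ 1) {P : ℤ} (l L : ℤ) (hL : 0 ≤ L) (hl : L ≤ l)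
    (hlP : l ≤ P - 2) (hpar : (2 : ℤ) ∣ L + l) :
    Xcfg q 1 P 1 (l + 1) 1 L = if l = L then 1 else 0 := by
  obtain ⟨u, hu⟩ := hpar
  rw [Xcfg_eq, tsum_eq_single 0]
  · rw [qBinI_out q (m := (L - (l + 1) - 1) / 2 - P * 0) (by omega)]
    split_ifs with h
    · have : (L + (l + 1) - 1) / 2 - P * 0 = L := by omega
      rw [this, qBinI_self h0 h1 hL]; simp
    · rw [qBinI_out q (by omega)]; simp
  · intro j hj
    have hc : P ≤ P * j ∨ P * j ≤ -P := by
      rcases lt_or_gt_of_ne hj with h | h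
      · right; nlinarith
      · left; nlinarith
    rw [qBinI_out q (by omega), qBinI_out q (by omega)]; simp

/-- The left-hand side. -/
def Fn (q : ℝ) (k : ℕ) (L M l : ℤ) : ℝ :=
  ∑ i ∈ Finset.range (k + 1),
      (if (2 : ℤ) ∣ ((i : ℤ) - L) then
        Xcfg q⁻¹ 1 ((k : ℤ) + 2) 1 ((i : ℤ) + 1) (l + 1) M *
          Xcfg q 1 ((k : ℤ) + 2) 1 ((i : ℤ) + 1) 1 L
      else 0)

theorem Fn_three {q : ℝ} (h0 : 0 < q) (h1 : q ≠ 1) (k : ℕ) (L M l : ℤ) (hM : 1 ≤ M) :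
    Fn q k L M l = Fn q k L (M - 1) (l + 1) + Fn q k L (M - 1) (l - 1)
      + (q ^ (1 - M) - 1) * Fn q k L (M - 2) l := by
  unfold Fn
  rw [Finset.mul_sum, ← Finset.sum_add_distrib, ← Finset.sum_add_distrib]
  refine Finset.sum_congr rfl fun i _ => ?_
  split_ifs
  · rw [X_three (inv_pos.2 h0) (by simpa using h1) (by omega) _ (l + 1) M hM]
    have e : q⁻¹ ^ (M - 1) = q ^ (1 - M) := by rw [inv_zpow, ← zpow_neg]; congr 1; ring
    rw [e, show l + 1 - 1 = l - 1 + 1 by ring]; ring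
  · simp

theorem Fn_low {q : ℝ} (h0 : 0 < q) (h1 : q ≠ 1) (k : ℕ) (L M : ℤ) (hM : 1 ≤ M)
    (hpar : (2 : ℤ) ∣ L + M) : Fn q k L M 0 = Fn q k L (M - 1) 1 := by
  unfold Fn
  refine Finset.sum_congr rfl fun i _ => ?_
  split_ifs with h
  · rw [show (0 : ℤ) + 1 = 1 by ring, show (1 : ℤ) + 1 = 2 by ring,
      X_low (inv_pos.2 h0) (by simpa using h1) (by omega) _ M hM (by omega)]
  · rfl

theorem Fn_top {q : ℝ} (k : ℕ) (L M : ℤ)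
    (hpar : (2 : ℤ) ∣ L + M + k + 1) : Fn q k L M (k + 1) = 0 := by
  unfold Fn
  refine Finset.sum_eq_zero fun i _ => ?_
  split_ifs with h
  · rw [show (k : ℤ) + 1 + 1 = k + 2 by ring, X_top (by omega) _ M (by omega)]; simp
  · rfl

theorem Fn_symm {q : ℝ} (k : ℕ) (L M : ℤ) (hpar : (2 : ℤ) ∣ L + M) :
    Fn q k L M 0 = Fn q⁻¹ k M L 0 := by
  unfold Fn
  refine Finset.sum_congr rfl fun i _ => ?_
  have : ((2 : ℤ) ∣ (i : ℤ) - L) ↔ ((2 : ℤ) ∣ (i : ℤ) - M) := by omega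
  simp only [this, inv_inv, zero_add]
  split_ifs
  · ring
  · rfl

theorem Fn_init {q : ℝ} (h0 : 0 < q) (h1 : q ≠ 1) (k : ℕ) (L l : ℤ) (hL : 0 ≤ L) (hl : L ≤ l)
    (hlk : l ≤ k) (hpar : (2 : ℤ) ∣ L + l) : Fn q k L 0 l = if l = L then 1 else 0 := by
  unfold Fn
  obtain ⟨t, rfl⟩ : ∃ t : ℕ, l = t := ⟨l.toNat, by omega⟩
  rw [Finset.sum_eq_single t]
  · rw [if_pos (by omega), X_zero (inv_pos.2 h0) (by simpa using h1) _ _ (by omega) (by omega)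
      (by omega) (by omega) (by simp), if_pos rfl, X_one h0 h1 _ L hL hl (by omega) hpar, one_mul]
  · intro i hi hit
    rw [Finset.mem_range] at hi
    split_ifs with h
    · rw [X_zero (inv_pos.2 h0) (by simpa using h1) _ _ (by omega) (by omega)
        (by omega) (by omega) (by omega), if_neg (by omega), zero_mul]
    · rfl
  · intro h; rw [Finset.mem_range] at h; omega

/-! ### the fermionic side -/

def nn (a : ℕ → ℤ) (i : ℕ) : ℤ := 2 * a i - a (i - 1) - a (i + 1)

def TT (N : ℤ) (l : ℕ) (a : ℕ → ℤ) (i : ℕ) : ℤ :=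
  N + min (i : ℤ) (l : ℤ) - a (i - 1) - a (i + 1)

def QQ (k : ℕ) (a : ℕ → ℤ) : ℤ := ∑ i ∈ Finset.range k, (a (i + 1) - a i) ^ 2

def WW (k : ℕ) (L M : ℤ) (l : ℕ) (A : ℤ) (a : ℕ → ℤ) : ℤ :=
  QQ k a - M * a 1 - a l - (L - A)

def Adm (k : ℕ) (A : ℤ) (a : ℕ → ℤ) : Prop := a 0 = 0 ∧ ∀ i, k ≤ i → a i = A

def Br (k : ℕ) (q : ℝ) (N : ℤ) (l : ℕ) (u v : ℕ → ℤ) (a : ℕ → ℤ) : ℝ :=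
  ∏ i ∈ Finset.Ico 1 k, qBinI q (TT N l a i - u i) (nn a i - v i)

open Classical in
def gen (k : ℕ) (q : ℝ) (L M : ℤ) (l : ℕ) (A : ℤ) (e : (ℕ → ℤ) → ℤ) (u v : ℕ → ℤ)
    (a : ℕ → ℤ) : ℝ :=
  if Adm k A a then q ^ (WW k L M l A a + e a) * Br k q (L + M) l u v a else 0

theorem conc (a : ℕ → ℤ) (k : ℕ) (h0 : a 0 = 0) (hn : ∀ i ∈ Finset.Ico 1 k, 0 ≤ nn a i) :
    ∀ i, i + 1 ≤ k → (i : ℤ) * a (i + 1) ≤ (i + 1) * a i := by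
  intro i
  induction i with
  | zero => intro _; simp [h0]
  | succ i ih =>
    intro hi
    have h1 := ih (by omega)
    have h2 := hn (i + 1) (by rw [Finset.mem_Ico]; omega)
    unfold nn at h2
    simp only [Nat.add_sub_cancel] at h2
    push_cast
    nlinarith

theorem low (a : ℕ → ℤ) (k : ℕ) (h0 : a 0 = 0) (hn : ∀ i ∈ Finset.Ico 1 k, 0 ≤ nn a i)
    (c : ℤ) (hc : c ≤ 0) (hk : c ≤ a k) : ∀ d i, i + d = k → c ≤ a i := by
  intro d
  induction d with
  | zero => intro i hi; simp at hi; rw [hi]; exact hk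
  | succ d ih =>
    intro i hi
    have h1 := ih (i + 1) (by omega)
    have h2 := conc a k h0 hn i (by omega)
    by_contra h
    push Not at h
    have : (i : ℤ) * c ≤ i * a (i + 1) := mul_le_mul_of_nonneg_left h1 (by omega)
    nlinarith

theorem box_finite (k : ℕ) (N : ℤ) (l : ℕ) (A : ℤ) :
    {a : ℕ → ℤ | Adm k A a ∧ ∀ i ∈ Finset.Ico 1 k, 0 ≤ nn a i ∧ nn a i ≤ TT N l a i}.Finite := by
  refine Set.Finite.of_injOn (f := fun (a : ℕ → ℤ) (i : Fin k) => a i)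
    (t := Set.pi Set.univ (fun _ => Set.Icc (-|A|) (|N| + l))) ?_ ?_
    (Set.Finite.pi fun _ => Set.finite_Icc _ _)
  · rintro a ⟨⟨h0, hA⟩, h⟩ i -
    have := low a k h0 (fun i hi => (h i hi).1) (-|A|) (by simp) (by rw [hA k le_rfl]; exact neg_abs_le A)
      (k - i) i (by omega)
    refine ⟨this, ?_⟩
    have hN : -|N| ≤ N ∧ N ≤ |N| ∧ 0 ≤ |N| := ⟨neg_abs_le N, le_abs_self N, abs_nonneg N⟩
    rcases Nat.eq_zero_or_pos (i : ℕ) with hi | hi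
    · simp only [hi, h0]; omega
    · have := h i (by rw [Finset.mem_Ico]; omega)
      unfold nn TT at this
      simp only
      omega
  · rintro a ⟨⟨h0, hA⟩, h⟩ b ⟨⟨h0', hA'⟩, h'⟩ hab
    ext i
    by_cases hi : i < k
    · exact congrFun hab ⟨i, hi⟩
    · rw [hA i (by omega), hA' i (by omega)]

theorem gen_supp {k : ℕ} {q : ℝ} {L M : ℤ} {l : ℕ} {A : ℤ} {e : (ℕ → ℤ) → ℤ} {u v : ℕ → ℤ}
    (hv : ∀ i, 0 ≤ v i) (huv : ∀ i, v i ≤ u i) : Function.support (gen k q L M l A e u v) ⊆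
    {a : ℕ → ℤ | Adm k A a ∧ ∀ i ∈ Finset.Ico 1 k, 0 ≤ nn a i ∧ nn a i ≤ TT (L + M) l a i} := by
  intro a ha
  rw [Function.mem_support] at ha
  unfold gen at ha
  split_ifs at ha with h
  · refine ⟨h, fun i hi => ?_⟩
    have h1 := right_ne_zero_of_mul ha
    unfold Br at h1
    have h2 := qBinI_ne q (Finset.prod_ne_zero_iff.1 h1 i hi)
    have := hv i
    have := huv i
    omega
  · exact absurd rfl ha

theorem gen_summable (k : ℕ) (q : ℝ) (L M : ℤ) (l : ℕ) (A : ℤ) (e : (ℕ → ℤ) → ℤ) (u v : ℕ → ℤ)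
    (hv : ∀ i, 0 ≤ v i) (huv : ∀ i, v i ≤ u i) : Summable (gen k q L M l A e u v) :=
  summable_of_hasFiniteSupport ((box_finite k (L + M) l A).subset (gen_supp hv huv))

/-- telescoping step -/
theorem tele {k : ℕ} {q : ℝ} (h0 : 0 < q) (h1 : q ≠ 1) {N : ℤ} {l : ℕ} {A : ℤ} {a : ℕ → ℤ}
    (hN : 0 ≤ N) (hA : 2 * A = N + l) (hl : l ≤ k) (ha : Adm k A a) (j : ℕ) (hj1 : 1 ≤ j)
    (hjl : j ≤ l) (hjk : j < k) (u0 u1 : ℕ → ℤ) (hu : ∀ i, 0 ≤ u0 i) (hj0 : u0 j = 0)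
    (hj1' : u1 j = 1) (hne : ∀ i, i ≠ j → u1 i = u0 i) :
    Br k q N l u0 (fun _ => 0) a = q ^ (nn a j) * Br k q N l u1 (fun _ => 0) a
      + Br k q N l u1 (fun i => if i = j then 1 else 0) a := by
  have hmem : j ∈ Finset.Ico 1 k := Finset.mem_Ico.2 ⟨hj1, hjk⟩
  unfold Br
  rw [← Finset.mul_prod_erase _ _ hmem, ← Finset.mul_prod_erase _ _ hmem,
    ← Finset.mul_prod_erase _ _ hmem]
  beta_reduce
  have e1 : ∏ x ∈ (Finset.Ico 1 k).erase j, qBinI q (TT N l a x - u1 x) (nn a x - 0) =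
      ∏ x ∈ (Finset.Ico 1 k).erase j, qBinI q (TT N l a x - u0 x) (nn a x - 0) := by
    refine Finset.prod_congr rfl fun i hi => ?_
    rw [hne i (Finset.ne_of_mem_erase hi)]
  have e2 : ∏ x ∈ (Finset.Ico 1 k).erase j,
      qBinI q (TT N l a x - u1 x) (nn a x - if x = j then 1 else 0) =
      ∏ x ∈ (Finset.Ico 1 k).erase j, qBinI q (TT N l a x - u0 x) (nn a x - 0) := by
    refine Finset.prod_congr rfl fun i hi => ?_
    rw [hne i (Finset.ne_of_mem_erase hi), if_neg (Finset.ne_of_mem_erase hi)]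
  rw [e1, e2, hj0, hj1', if_pos rfl]
  simp only [sub_zero]
  by_cases hz : TT N l a j ≠ 0 ∨ nn a j ≠ 0
  · rw [qBinI_pascal h0 h1 _ _ hz]; ring
  · push Not at hz
    have hR : ∏ x ∈ (Finset.Ico 1 k).erase j, qBinI q (TT N l a x - u0 x) (nn a x) = 0 := by
      by_contra hR
      rw [← ne_eq, Finset.prod_ne_zero_iff] at hR
      obtain ⟨hz1, hz2⟩ := hz
      have p1 : 0 ≤ N + ((j : ℤ) - 1) - 2 * a (j - 1) := by
        rcases Nat.eq_or_lt_of_le hj1 with h | h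
        · rw [← h]; simp [ha.1, hN]
        · have := qBinI_ne q (hR (j - 1) (by
            rw [Finset.mem_erase, Finset.mem_Ico]; omega))
          have := hu (j - 1)
          unfold TT nn at *
          omega
      have p2 : 0 ≤ N + min ((j : ℤ) + 1) l - 2 * a (j + 1) := by
        rcases Nat.eq_or_lt_of_le hjk with h | h
        · rw [ha.2 (j + 1) (by omega)]; omega
        · have := qBinI_ne q (hR (j + 1) (by
            rw [Finset.mem_erase, Finset.mem_Ico]; omega))
          have := hu (j + 1)
          unfold TT nn at *
          simp only [Nat.add_sub_cancel] at *
          omega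
      unfold TT nn at *
      omega
    rw [hR]; ring

theorem QQ_shift (k : ℕ) (a : ℕ → ℤ) (j : ℕ) (hj1 : 1 ≤ j) (hjk : j ≤ k) :
    QQ k (a - fun i => if j ≤ i then 1 else 0) = QQ k a - 2 * (a j - a (j - 1)) + 1 := by
  unfold QQ
  have : ∀ i ∈ Finset.range k,
      ((a - fun i => if j ≤ i then (1 : ℤ) else 0) (i + 1) - (a - fun i => if j ≤ i then (1 : ℤ) else 0) i) ^ 2
      = (a (i + 1) - a i) ^ 2 + if i = j - 1 then (- 2 * (a j - a (j - 1)) + 1) else 0 := by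
    intro i _
    simp only [Pi.sub_apply]
    by_cases h : i = j - 1
    · have h2 : i + 1 = j := by omega
      rw [if_pos h, if_pos (by omega), if_neg (by omega), h2, ← h]; ring
    · rw [if_neg h]
      by_cases h3 : j ≤ i
      · rw [if_pos (by omega), if_pos h3]; ring
      · rw [if_neg (by omega), if_neg h3]; ring
  rw [Finset.sum_congr rfl this, Finset.sum_add_distrib, Finset.sum_ite_eq', if_pos (by
    rw [Finset.mem_range]; omega)]
  ring

theorem Adm_shift (k : ℕ) (A : ℤ) (a : ℕ → ℤ) (j : ℕ) (hj1 : 1 ≤ j) (hjk : j ≤ k) :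
    Adm k (A - 1) (a - fun i => if j ≤ i then 1 else 0) ↔ Adm k A a := by
  unfold Adm
  simp only [Pi.sub_apply]
  rw [if_neg (by omega), sub_zero]
  refine and_congr Iff.rfl (forall_congr' fun i => ?_)
  constructor
  · intro h hi
    have := h hi
    rw [if_pos (by omega)] at this; omega
  · intro h hi
    rw [if_pos (by omega), h hi]

def Pj (k : ℕ) (q : ℝ) (L M : ℤ) (l : ℕ) (A : ℤ) (j : ℕ) : (ℕ → ℤ) → ℝ :=
  gen k q L M l A (fun a => a 1 - a j + a (j - 1)) (fun i => if i < j then 1 else 0) (fun _ => 0)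

def Aj (k : ℕ) (q : ℝ) (L M : ℤ) (l : ℕ) (A : ℤ) (j : ℕ) : (ℕ → ℤ) → ℝ :=
  gen k q L M l A (fun a => a 1 - a j + a (j - 1)) (fun i => if i ≤ j then 1 else 0)
    (fun i => if i = j then 1 else 0)

def Pj' (k : ℕ) (q : ℝ) (L M : ℤ) (l : ℕ) (A : ℤ) (j : ℕ) : (ℕ → ℤ) → ℝ :=
  gen k q L M l A (fun a => a j - a (j - 1) - a (l + 1) + a l)
    (fun i => if j ≤ i ∧ i ≤ l then 1 else 0) (fun _ => 0)

def Aj' (k : ℕ) (q : ℝ) (L M : ℤ) (l : ℕ) (A : ℤ) (j : ℕ) : (ℕ → ℤ) → ℝ :=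
  gen k q L M l A (fun a => a (j + 1) - a j - a (l + 1) + a l)
    (fun i => if j ≤ i ∧ i ≤ l then 1 else 0) (fun i => if i = j then 1 else 0)

def Full (k : ℕ) (q : ℝ) (L M : ℤ) (l : ℕ) (A : ℤ) : (ℕ → ℤ) → ℝ :=
  gen k q L M l A (fun _ => 0) (fun _ => 0) (fun _ => 0)

theorem Pj_step {k : ℕ} {q : ℝ} (h0 : 0 < q) (h1 : q ≠ 1) {L M : ℤ} {l : ℕ} {A : ℤ}
    (hN : 0 ≤ L + M) (hA : 2 * A = L + M + l) (hl : l ≤ k) (j : ℕ) (hj1 : 1 ≤ j)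
    (hjl : j ≤ l) (hjk : j < k) (a : ℕ → ℤ) :
    Pj k q L M l A j a = Aj k q L M l A j a + Pj k q L M l A (j + 1) a := by
  unfold Pj Aj gen
  split_ifs with ha
  · rw [tele h0 h1 hN hA hl ha j hj1 hjl hjk (fun i => if i < j then 1 else 0) (fun i => if i ≤ j then 1 else 0)
      (by intro i; split_ifs <;> norm_num) (by simp) (by simp)
      (by intro i hi; congr 1; simp only [eq_iff_iff]; omega)]
    have e1 : (fun i => if i < j + 1 then (1 : ℤ) else 0) = (fun i => if i ≤ j then 1 else 0) := by
      ext i; congr 1; simp only [eq_iff_iff]; omega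
    have e2 : q ^ (WW k L M l A a + (a 1 - a (j + 1) + a (j + 1 - 1))) =
        q ^ (WW k L M l A a + (a 1 - a j + a (j - 1))) * q ^ (nn a j) := by
      rw [← zpow_add₀ h0.ne']; congr 1; unfold nn; simp only [Nat.add_sub_cancel]; ring
    rw [e1, e2]; ring
  · simp

theorem Pj'_step {k : ℕ} {q : ℝ} (h0 : 0 < q) (h1 : q ≠ 1) {L M : ℤ} {l : ℕ} {A : ℤ}
    (hN : 0 ≤ L + M) (hA : 2 * A = L + M + l) (hl : l < k) (j : ℕ) (hj1 : 1 ≤ j)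
    (hjl : j ≤ l) (a : ℕ → ℤ) :
    Pj' k q L M l A (j + 1) a = Aj' k q L M l A j a + Pj' k q L M l A j a := by
  unfold Pj' Aj' gen
  split_ifs with ha
  · rw [tele h0 h1 hN hA hl.le ha j hj1 hjl (by omega) (fun i => if j + 1 ≤ i ∧ i ≤ l then 1 else 0) (fun i => if j ≤ i ∧ i ≤ l then 1 else 0)
      (by intro i; split_ifs <;> norm_num) (by simp) (by simp [hjl])
      (by intro i hi; congr 1; simp only [eq_iff_iff]; omega)]
    have e2 : q ^ (WW k L M l A a + (a j - a (j - 1) - a (l + 1) + a l)) =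
        q ^ (WW k L M l A a + (a (j + 1) - a j - a (l + 1) + a l)) * q ^ (nn a j) := by
      rw [← zpow_add₀ h0.ne']; congr 1; unfold nn; ring
    simp only [Nat.add_sub_cancel]
    rw [e2]; ring
  · simp

theorem Pj_one (k : ℕ) (q : ℝ) (L M : ℤ) (l : ℕ) (A : ℤ) (a : ℕ → ℤ) :
    Pj k q L M l A 1 a = Full k q L M l A a := by
  unfold Pj Full gen
  split_ifs with ha
  · have : Br k q (L + M) l (fun i => if i < 1 then 1 else 0) (fun _ => 0) a =
        Br k q (L + M) l (fun _ => 0) (fun _ => 0) a := by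
      unfold Br
      refine Finset.prod_congr rfl fun i hi => ?_
      rw [Finset.mem_Ico] at hi
      beta_reduce
      rw [if_neg (by omega)]
    rw [this]; simp [ha.1]
  · rfl

theorem Pj'_last (k : ℕ) (q : ℝ) (L M : ℤ) (l : ℕ) (A : ℤ) (a : ℕ → ℤ) :
    Pj' k q L M l A (l + 1) a = Full k q L M l A a := by
  unfold Pj' Full gen
  split_ifs with ha
  · have : Br k q (L + M) l (fun i => if l + 1 ≤ i ∧ i ≤ l then 1 else 0) (fun _ => 0) a =
        Br k q (L + M) l (fun _ => 0) (fun _ => 0) a := by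
      unfold Br
      refine Finset.prod_congr rfl fun i hi => ?_
      beta_reduce
      rw [if_neg (by omega)]
    rw [this]; simp
  · rfl

theorem Pj'_first (k : ℕ) (q : ℝ) (L M : ℤ) (l : ℕ) (A : ℤ) (a : ℕ → ℤ) :
    Pj' k q L M l A 1 a = Pj k q L M l A (l + 1) a := by
  unfold Pj' Pj gen
  split_ifs with ha
  · congr 1
    · congr 1; simp [ha.1]
    · unfold Br
      refine Finset.prod_congr rfl fun i hi => ?_
      rw [Finset.mem_Ico] at hi
      have : (1 ≤ i ∧ i ≤ l) ↔ i < l + 1 := by omega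
      simp only [this]
  · rfl

theorem Aj_last (k : ℕ) (q : ℝ) (L M : ℤ) (l : ℕ) (A : ℤ) (a : ℕ → ℤ) :
    Aj k q L M l A k a = Pj k q L M l A k a := by
  unfold Aj Pj gen
  split_ifs with ha
  · congr 1
    unfold Br
    refine Finset.prod_congr rfl fun i hi => ?_
    rw [Finset.mem_Ico] at hi
    beta_reduce
    rw [if_pos (show i ≤ k by omega), if_pos (show i < k by omega), if_neg (show ¬ i = k by omega)]
  · rfl

/-- M3 -/
theorem Pj_shift {k : ℕ} {q : ℝ} {L M : ℤ} {l : ℕ} {A : ℤ} (a : ℕ → ℤ) :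
    Pj k q L M l A (l + 1) a = Full k q L (M - 1) (l + 1) A a := by
  unfold Pj Full gen
  split_ifs with ha
  · congr 1
    · congr 1; unfold WW; simp only [Nat.add_sub_cancel]; ring
    · unfold Br
      refine Finset.prod_congr rfl fun i hi => ?_
      congr 1
      unfold TT
      push_cast
      split_ifs <;> omega
  · rfl

/-- M1 -/
theorem Aj_one {k : ℕ} (hk : 1 ≤ k) {q : ℝ} (h0 : 0 < q) {L M : ℤ} {l : ℕ} (hl : 1 ≤ l) {A : ℤ}
    (a : ℕ → ℤ) :
    Aj k q L M l A 1 a = q ^ (1 - M) *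
      Full k q L (M - 2) l (A - 1) (a - fun i => if 1 ≤ i then 1 else 0) := by
  unfold Aj Full gen
  by_cases ha : Adm k A a
  swap
  · rw [if_neg ha, if_neg (fun h => ha ((Adm_shift k A a 1 le_rfl hk).1 h))]; simp
  rw [if_pos ha, if_pos ((Adm_shift k A a 1 le_rfl hk).2 ha)]
  · rw [← mul_assoc, ← zpow_add₀ h0.ne']
    congr 1
    · congr 1; unfold WW; rw [QQ_shift k a 1 le_rfl hk]
      simp [hl, ha.1]; ring
    · unfold Br
      refine Finset.prod_congr rfl fun i hi => ?_
      rw [Finset.mem_Ico] at hi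
      unfold TT nn
      simp only [Pi.sub_apply]
      rcases Nat.eq_or_lt_of_le hi.1 with h | h
      · subst h; simp; congr 1 <;> ring
      · rw [if_neg (by omega), if_neg (by omega), if_pos (by omega), if_pos (by omega),
          if_pos (by omega)]
        congr 1 <;> ring

/-- M2 -/
theorem Aj_shift {k : ℕ} {q : ℝ} {L M : ℤ} {l : ℕ} {A : ℤ} (j : ℕ) (hj : 1 ≤ j)
    (hjl : j ≤ l) (hlk : l + 1 ≤ k) (a : ℕ → ℤ) :
    Aj k q L M (l + 1) A (j + 1) a =
      Aj' k q L (M - 1) l (A - 1) j (a - fun i => if j + 1 ≤ i then 1 else 0) := by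
  unfold Aj Aj' gen
  by_cases ha : Adm k A a
  swap
  · rw [if_neg ha, if_neg (fun h => ha ((Adm_shift k A a (j + 1) (by omega) (by omega)).1 h))]
  rw [if_pos ha, if_pos ((Adm_shift k A a (j + 1) (by omega) (by omega)).2 ha)]
  · congr 1
    · congr 1; unfold WW; rw [QQ_shift k a (j + 1) (by omega) (by omega)]
      simp only [Pi.sub_apply, Nat.add_sub_cancel]
      rw [if_neg (show ¬ (j + 1 ≤ 1) by omega), if_pos le_rfl, if_neg (show ¬ (j + 1 ≤ j) by omega),
        if_pos (show j + 1 ≤ l + 1 by omega)]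
      ring
    · unfold Br
      refine Finset.prod_congr rfl fun i hi => ?_
      rw [Finset.mem_Ico] at hi
      unfold TT nn
      simp only [Pi.sub_apply]
      push_cast
      congr 1 <;> split_ifs <;> omega


/-! ### recursions for the fermionic sum -/

def GA (k : ℕ) (q : ℝ) (L M : ℤ) (l : ℕ) (A : ℤ) : ℝ := ∑' a, Full k q L M l A a

theorem GA_zero (k : ℕ) (q : ℝ) (L M : ℤ) (A : ℤ) : GA k q L M 0 A = GA k q L (M - 1) 1 A := by
  unfold GA
  refine tsum_congr fun a => ?_
  rw [← Pj_one, ← Pj_shift]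

theorem Pj_sm (k : ℕ) (q : ℝ) (L M : ℤ) (l : ℕ) (A : ℤ) (j : ℕ) : Summable (Pj k q L M l A j) :=
  gen_summable _ _ _ _ _ _ _ _ _ (fun _ => le_rfl) (fun i => by split_ifs <;> norm_num)

theorem Pj'_sm (k : ℕ) (q : ℝ) (L M : ℤ) (l : ℕ) (A : ℤ) (j : ℕ) : Summable (Pj' k q L M l A j) :=
  gen_summable _ _ _ _ _ _ _ _ _ (fun _ => le_rfl) (fun i => by split_ifs <;> norm_num)

theorem Aj_sm (k : ℕ) (q : ℝ) (L M : ℤ) (l : ℕ) (A : ℤ) (j : ℕ) : Summable (Aj k q L M l A j) :=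
  gen_summable _ _ _ _ _ _ _ _ _ (fun i => by split_ifs <;> norm_num)
    (fun i => by split_ifs <;> first | omega | norm_num)

theorem Aj'_sm (k : ℕ) (q : ℝ) (L M : ℤ) (l : ℕ) (A : ℤ) (j : ℕ) (hj : j ≤ l) :
    Summable (Aj' k q L M l A j) :=
  gen_summable _ _ _ _ _ _ _ _ _ (fun i => by split_ifs <;> norm_num)
    (fun i => by split_ifs <;> first | omega | norm_num)

theorem Pj_sum {k : ℕ} {q : ℝ} (h0 : 0 < q) (h1 : q ≠ 1) {L M : ℤ} {l : ℕ} {A : ℤ}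
    (hN : 0 ≤ L + M) (hA : 2 * A = L + M + l) (hl : l ≤ k) (J : ℕ) (hJ : J ≤ l) (hJk : J + 1 ≤ k) :
    GA k q L M l A = ∑ j ∈ Finset.range J, ∑' a, Aj k q L M l A (j + 1) a
      + ∑' a, Pj k q L M l A (J + 1) a := by
  induction J with
  | zero => simp only [Finset.range_zero, Finset.sum_empty, zero_add]; unfold GA
            exact tsum_congr fun a => (Pj_one _ _ _ _ _ _ a).symm
  | succ J ih =>
    rw [ih (by omega) (by omega), Finset.sum_range_succ, add_assoc,
      ← (Aj_sm _ _ _ _ _ _ _).tsum_add (Pj_sm _ _ _ _ _ _ _)]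
    congr 1
    exact tsum_congr fun a => Pj_step h0 h1 hN hA hl (J + 1) (by omega) hJ (by omega) a

theorem Pj'_sum {k : ℕ} {q : ℝ} (h0 : 0 < q) (h1 : q ≠ 1) {L M : ℤ} {l : ℕ} {A : ℤ}
    (hN : 0 ≤ L + M) (hA : 2 * A = L + M + l) (hl : l < k) (J : ℕ) (hJ : J ≤ l) :
    ∑' a, Pj' k q L M l A (J + 1) a = ∑ j ∈ Finset.range J, ∑' a, Aj' k q L M l A (j + 1) a
      + ∑' a, Pj' k q L M l A 1 a := by
  induction J with
  | zero => simp
  | succ J ih =>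
    have := ih (by omega)
    have e : ∑' a, Pj' k q L M l A (J + 1 + 1) a = ∑' a, Aj' k q L M l A (J + 1) a +
        ∑' a, Pj' k q L M l A (J + 1) a := by
      rw [← (Aj'_sm _ _ _ _ _ _ _ hJ).tsum_add (Pj'_sm _ _ _ _ _ _ _)]
      exact tsum_congr fun a => Pj'_step h0 h1 hN hA hl (J + 1) (by omega) hJ a
    rw [Finset.sum_range_succ, e, this]; ring

theorem tsum_shift (f : (ℕ → ℤ) → ℝ) (c : ℕ → ℤ) : ∑' a, f (a - c) = ∑' a, f a :=
  (Equiv.subRight c).tsum_eq f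

theorem GA_sumA {k : ℕ} {q : ℝ} (h0 : 0 < q) (h1 : q ≠ 1) {L M : ℤ} {l : ℕ} {A : ℤ}
    (hN : 1 ≤ L + M) (hA : 2 * A = L + M + (l + 1)) (hl : l + 1 ≤ k) :
    ∑ j ∈ Finset.range (l + 1), ∑' a, Aj k q L M (l + 1) A (j + 1) a =
      GA k q L (M - 1) l (A - 1) + (q ^ (1 - M) - 1) * GA k q L (M - 2) (l + 1) (A - 1) := by
  rw [Finset.sum_range_succ']
  have e1 : ∑' a, Aj k q L M (l + 1) A (0 + 1) a =
      q ^ (1 - M) * GA k q L (M - 2) (l + 1) (A - 1) := by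
    unfold GA
    rw [← tsum_shift (Full k q L (M - 2) (l + 1) (A - 1)) (fun i => if 1 ≤ i then 1 else 0), ← tsum_mul_left]
    exact tsum_congr fun a => Aj_one (by omega) h0 (by omega) a
  have e2 : ∑ j ∈ Finset.range l, ∑' a, Aj k q L M (l + 1) A (j + 1 + 1) a =
      ∑ j ∈ Finset.range l, ∑' a, Aj' k q L (M - 1) l (A - 1) (j + 1) a := by
    refine Finset.sum_congr rfl fun j hj => ?_
    rw [Finset.mem_range] at hj
    rw [← tsum_shift (Aj' k q L (M - 1) l (A - 1) (j + 1)) (fun i => if j + 1 + 1 ≤ i then 1 else 0)]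
    exact tsum_congr fun a => Aj_shift (j + 1) (by omega) (by omega) hl a
  have e3 := Pj'_sum h0 h1 (L := L) (M := M - 1) (l := l) (A := A - 1) (k := k)
    (by omega) (by omega) (by omega) l le_rfl
  have e4 : ∑' a, Pj' k q L (M - 1) l (A - 1) (l + 1) a = GA k q L (M - 1) l (A - 1) :=
    tsum_congr fun a => Pj'_last _ _ _ _ _ _ a
  have e5 : ∑' a, Pj' k q L (M - 1) l (A - 1) 1 a = GA k q L (M - 2) (l + 1) (A - 1) := by
    refine tsum_congr fun a => ?_
    rw [Pj'_first, Pj_shift, sub_sub]; norm_num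
  rw [e1, e2]
  rw [e4, e5] at e3
  linear_combination -e3

theorem GA_three {k : ℕ} {q : ℝ} (h0 : 0 < q) (h1 : q ≠ 1) {L M : ℤ} {l : ℕ} {A : ℤ}
    (hN : 1 ≤ L + M) (hA : 2 * A = L + M + (l + 1)) (hl : l + 1 < k) :
    GA k q L M (l + 1) A = GA k q L (M - 1) (l + 2) A + GA k q L (M - 1) l (A - 1)
      + (q ^ (1 - M) - 1) * GA k q L (M - 2) (l + 1) (A - 1) := by
  have h := Pj_sum h0 h1 (k := k) (L := L) (M := M) (l := l + 1) (A := A) (by omega)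
    (by push_cast; omega) (by omega) (l + 1) le_rfl (by omega)
  rw [GA_sumA h0 h1 hN hA (by omega)] at h
  rw [h]
  have : ∑' a, Pj k q L M (l + 1) A (l + 1 + 1) a = GA k q L (M - 1) (l + 2) A :=
    tsum_congr fun a => Pj_shift a
  rw [this]; ring

theorem GA_top {k : ℕ} {q : ℝ} (h0 : 0 < q) (h1 : q ≠ 1) {L M : ℤ} {l : ℕ} {A : ℤ}
    (hN : 1 ≤ L + M) (hA : 2 * A = L + M + (l + 1)) (hl : l + 1 = k) :
    GA k q L M (l + 1) A = GA k q L (M - 1) l (A - 1)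
      + (q ^ (1 - M) - 1) * GA k q L (M - 2) (l + 1) (A - 1) := by
  have h := Pj_sum h0 h1 (k := k) (L := L) (M := M) (l := l + 1) (A := A) (by omega)
    (by push_cast; omega) (by omega) l (by omega) (by omega)
  rw [← GA_sumA h0 h1 hN hA (by omega), Finset.sum_range_succ, h]
  congr 1
  refine tsum_congr fun a => ?_
  subst hl
  exact (Aj_last _ _ _ _ _ _ a).symm

theorem sum_nn (a : ℕ → ℤ) (K : ℕ) :
    ∑ i ∈ Finset.Ico 1 (K + 1), nn a i = a K - a (K + 1) + a 1 - a 0 := by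
  induction K with
  | zero => simp
  | succ K ih =>
    rw [Finset.sum_Ico_succ_top (by omega), ih]; unfold nn; simp only [Nat.add_sub_cancel]; ring

theorem sum_nn_a (a : ℕ → ℤ) (h0 : a 0 = 0) (K : ℕ) :
    ∑ i ∈ Finset.Ico 1 (K + 1), nn a i * a i = QQ (K + 1) a + a K * a (K + 1) - a (K + 1) ^ 2 := by
  induction K with
  | zero => simp [QQ, h0]
  | succ K ih =>
    rw [Finset.sum_Ico_succ_top (by omega), ih]; unfold nn QQ
    rw [Finset.sum_range_succ _ (K + 1)]; simp only [Nat.add_sub_cancel]; ring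

theorem prod_zpow_sum {q : ℝ} (h0 : 0 < q) (s : Finset ℕ) (f : ℕ → ℤ) :
    ∏ i ∈ s, q ^ f i = q ^ (∑ i ∈ s, f i) := by
  classical
  induction s using Finset.induction_on with
  | empty => simp
  | insert x s hx ih => rw [Finset.prod_insert hx, Finset.sum_insert hx, ih, zpow_add₀ h0.ne']

theorem GA_symm {k : ℕ} (hk : 1 ≤ k) {q : ℝ} (h0 : 0 < q) (h1 : q ≠ 1) {L M : ℤ} {A : ℤ}
    (hA : 2 * A = L + M) : GA k q L M 0 A = GA k q⁻¹ M L 0 A := by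
  unfold GA
  refine tsum_congr fun a => ?_
  unfold Full gen
  split_ifs with ha
  swap
  · rfl
  obtain ⟨K, rfl⟩ : ∃ K, k = K + 1 := ⟨k - 1, by omega⟩
  unfold Br
  simp only [sub_zero, add_zero]
  have : ∀ i ∈ Finset.Ico 1 (K + 1), qBinI q⁻¹ (TT (M + L) 0 a i) (nn a i) =
      q ^ (-((L + M) * nn a i - 2 * (nn a i * a i))) * qBinI q (TT (L + M) 0 a i) (nn a i) := by
    intro i hi
    rw [qBinI_inv h0 h1, add_comm M L]
    congr 2
    unfold TT nn
    simp; ring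
  rw [Finset.prod_congr rfl this, Finset.prod_mul_distrib, prod_zpow_sum h0, ← mul_assoc]
  congr 1
  rw [inv_zpow, ← zpow_neg, ← zpow_add₀ h0.ne', Finset.sum_neg_distrib, Finset.sum_sub_distrib,
    ← Finset.mul_sum, ← Finset.mul_sum, sum_nn a K, sum_nn_a a ha.1]
  congr 1
  unfold WW
  rw [ha.1, ha.2 (K + 1) le_rfl]
  linear_combination (1 - a K + A) * hA

theorem inc_mono (a : ℕ → ℤ) (k : ℕ) (hn : ∀ i ∈ Finset.Ico 1 k, 0 ≤ nn a i) (c : ℤ) (j : ℕ)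
    (hj : j < k) (h : c ≤ a (j + 1) - a j) : ∀ d i, i + d = j → c ≤ a (i + 1) - a i := by
  intro d
  induction d with
  | zero => intro i hi; simp at hi; subst hi; exact h
  | succ d ih =>
    intro i hi
    have h1 := ih (i + 1) (by omega)
    have h2 := hn (i + 1) (by rw [Finset.mem_Ico]; omega)
    unfold nn at h2
    simp only [Nat.add_sub_cancel] at h2
    omega

theorem init_unique (k : ℕ) (L : ℤ) (l : ℕ) (A : ℤ) (hL : 0 ≤ L) (hl : L ≤ l)
    (hlk : l ≤ k) (hA : 2 * A = L + l) (a : ℕ → ℤ) (ha : Adm k A a)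
    (h : ∀ i ∈ Finset.Ico 1 k, 0 ≤ nn a i ∧ nn a i ≤ TT (L + 0) l a i) :
    (l : ℤ) = L ∧ a = fun i : ℕ => min (i : ℤ) l := by
  obtain ⟨h0, hk⟩ := ha
  have hn : ∀ i ∈ Finset.Ico 1 k, 0 ≤ nn a i := fun i hi => (h i hi).1
  have hm : ∀ i, i ≤ k → 2 * a i ≤ L + min (i : ℤ) l := by
    intro i hi
    rcases Nat.eq_zero_or_pos i with h3 | h3
    · subst h3; rw [h0]; simp; exact hL
    · rcases Nat.eq_or_lt_of_le hi with h4 | h4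
      · rw [hk i h4.ge]; omega
      · have := (h i (by rw [Finset.mem_Ico]; omega)).2
        unfold TT nn at this
        omega
  rcases Nat.eq_zero_or_pos l with hl0 | hl0
  · subst hl0
    refine ⟨by omega, ?_⟩
    ext i
    by_cases hi : i ≤ k
    · have := low a k h0 hn 0 le_rfl (by rw [hk k le_rfl]; omega) (k - i) i (by omega)
      have := hm i hi
      simp at *; omega
    · rw [hk i (by omega)]; simp at *; omega
  · obtain ⟨l, rfl⟩ : ∃ m, l = m + 1 := ⟨l - 1, by omega⟩
    push_cast at *
    have hl1 := hm l (by omega)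
    have b1 : 1 ≤ a (l + 1) - a l := by
      by_contra hb
      have dec : ∀ d, l + d ≤ k → a (l + d) ≤ a l := by
        intro d
        induction d with
        | zero => intro _; simp
        | succ d ih =>
          intro hd
          have := ih (by omega)
          by_contra hc
          apply hb
          exact inc_mono a k hn 1 (l + d) (by omega) (by rw [← add_assoc] at hc; omega) d l rfl
      have := dec (k - l) (by omega)
      rw [show l + (k - l) = k by omega, hk k le_rfl] at this
      omega
    have b2 : ∀ i, i ≤ l → 1 ≤ a (i + 1) - a i := fun i hi =>
      inc_mono a k hn 1 l (by omega) b1 (l - i) i (by omega)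
    have b3 : ∀ i, i ≤ l + 1 → (i : ℤ) ≤ a i := by
      intro i
      induction i with
      | zero => intro _; simp [h0]
      | succ i ih =>
        intro hi
        have := ih (by omega)
        have := b2 i (by omega)
        push_cast; omega
    have b4 := b3 l (by omega)
    have hlL : (l : ℤ) + 1 = L := by omega
    refine ⟨hlL, ?_⟩
    have b5 : ∀ d i, i + d = l → a i ≤ i := by
      intro d
      induction d with
      | zero => intro i hi; simp at hi; subst hi; omega
      | succ d ih =>
        intro i hi
        have := ih (i + 1) (by omega)
        have := b2 i (by omega)
        push_cast at *; omega
    have b6 : ∀ i, l + 1 ≤ i → i < k → 0 ≤ a (i + 1) - a i := by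
      intro i h1 h2
      refine inc_mono a k hn 0 (k - 1) (by omega) ?_ (k - 1 - i) i (by omega)
      have := hm (k - 1) (by omega)
      rw [show k - 1 + 1 = k by omega, hk k le_rfl]
      omega
    have b7 : ∀ d, l + 1 + d ≤ k → A ≤ a (l + 1 + d) := by
      intro d
      induction d with
      | zero => intro _; have := b3 (l + 1) le_rfl; push_cast at this; simp; omega
      | succ d ih =>
        intro hd
        have := ih (by omega)
        have := b6 (l + 1 + d) (by omega) (by omega)
        rw [← add_assoc]; omega
    ext i
    by_cases hi : i ≤ l
    · have := b3 i (by omega)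
      have := b5 (l - i) i (by omega)
      omega
    · by_cases hik : i ≤ k
      · have := b7 (i - (l + 1)) (by omega)
        rw [show l + 1 + (i - (l + 1)) = i by omega] at this
        have := hm i hik
        omega
      · rw [hk i (by omega)]; omega

theorem GA_init {k : ℕ} {q : ℝ} (h0 : 0 < q) (h1 : q ≠ 1) (L : ℤ) (l : ℕ) (A : ℤ) (hL : 0 ≤ L)
    (hl : L ≤ l) (hlk : l ≤ k) (hA : 2 * A = L + l) :
    GA k q L 0 l A = if (l : ℤ) = L then 1 else 0 := by
  have hs : ∀ a, Full k q L 0 l A a ≠ 0 → (l : ℤ) = L ∧ a = fun i : ℕ => min (i : ℤ) l := by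
    intro a ha
    have := gen_supp (fun _ => le_rfl) (fun _ => le_rfl) ha
    exact init_unique k L l A hL hl hlk hA a this.1 this.2
  unfold GA
  split_ifs with hlL
  · rw [tsum_eq_single (fun i : ℕ => min (i : ℤ) l) (fun a ha => by
      by_contra hc; exact ha (hs a hc).2)]
    unfold Full gen
    rw [if_pos ⟨by simp, fun i hi => by show min (i : ℤ) l = A; omega⟩]
    have hQ : QQ k (fun i : ℕ => min (i : ℤ) l) = l := by
      unfold QQ
      have : ∀ i ∈ Finset.range k, (min ((i + 1 : ℕ) : ℤ) l - min (i : ℤ) l) ^ 2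
          = if i < l then 1 else 0 := by
        intro i _
        split_ifs with h
        · rw [show min ((i + 1 : ℕ) : ℤ) l - min (i : ℤ) l = 1 by omega]; norm_num
        · rw [show min ((i + 1 : ℕ) : ℤ) l - min (i : ℤ) l = 0 by omega]; norm_num
      rw [Finset.sum_congr rfl this, Finset.sum_boole]
      have : (Finset.range k).filter (fun i => i < l) = Finset.range l := by
        ext i; simp; omega
      rw [this]; simp
    have hB : Br k q (L + 0) l (fun _ => 0) (fun _ => 0) (fun i : ℕ => min (i : ℤ) l) = 1 := by
      unfold Br
      refine Finset.prod_eq_one fun i hi => ?_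
      rw [Finset.mem_Ico] at hi
      unfold TT nn
      beta_reduce
      by_cases h : i = l
      · rw [show (L + 0 + min (i : ℤ) l - min ((i - 1 : ℕ) : ℤ) l - min ((i + 1 : ℕ) : ℤ) l - 0) = 1 by omega,
          show (2 * min (i : ℤ) l - min ((i - 1 : ℕ) : ℤ) l - min ((i + 1 : ℕ) : ℤ) l - 0) = 1 by omega]
        exact qBinI_self h0 h1 (by norm_num)
      · rw [show (2 * min (i : ℤ) l - min ((i - 1 : ℕ) : ℤ) l - min ((i + 1 : ℕ) : ℤ) l - 0) = 0 by omega]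
        exact qBinI_zero h0 h1 (by omega)
    rw [hB]
    unfold WW
    rw [hQ]
    have : ((l : ℤ) - 0 * (fun i : ℕ => min (i : ℤ) l) 1 - (fun i : ℕ => min (i : ℤ) l) l - (L - A) + 0) = 0 := by
      simp; omega
    rw [this]; simp
  · rw [tsum_congr (g := fun _ => 0) fun a => by by_contra hc; exact hlL (hs a hc).1]
    simp

theorem Fn_GA {k : ℕ} (hk : 1 ≤ k) : ∀ L : ℕ, ∀ q : ℝ, 0 < q → q ≠ 1 → ∀ M l : ℕ, l ≤ k → ∀ A : ℤ,
    2 * A = L + M + l → Fn q k L M l = GA k q L M l A := by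
  intro L
  induction L using Nat.strong_induction_on with
  | _ L ihL =>
  intro q h0 h1
  have c1 : ∀ l : ℕ, ∀ M : ℕ, M + l < L → l ≤ k → ∀ A : ℤ, 2 * A = L + M + l →
      Fn q k L M l = GA k q L M l A := by
    intro l
    induction l using Nat.strong_induction_on with
    | _ l ihl =>
    intro M hM hl A hA
    rcases l with _ | _ | l
    · simp only [Nat.cast_zero, add_zero] at *
      rw [Fn_symm k L M ⟨A, by omega⟩, GA_symm hk h0 h1 (by omega)]
      have := ihL M hM q⁻¹ (inv_pos.2 h0) (by simpa using h1) L 0 (by omega) A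
        (by push_cast; omega)
      simpa using this
    · have e1 := Fn_low h0 h1 k L (M + 1) (by omega) ⟨A, by push_cast at *; omega⟩
      have e2 := GA_zero k q L (M + 1) A
      have e3 := ihl 0 (by omega) (M + 1) (by omega) (by omega) A (by push_cast at *; omega)
      simp only [add_sub_cancel_right] at e1 e2
      push_cast at *
      try simp only [zero_add] at e3 ⊢
      rw [← e1, ← e2, ← e3]
    · have e1 := Fn_three h0 h1 k L (M + 1) (l + 1) (by omega)
      have e2 := GA_three h0 h1 (k := k) (L := L) (M := M + 1) (l := l) (A := A) (by omega)
        (by push_cast at *; omega) (by omega)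
      have e3 := ihl (l + 1) (by omega) (M + 1) (by omega) (by omega) A (by push_cast at *; omega)
      have e4 := ihl l (by omega) M (by omega) (by omega) (A - 1) (by push_cast at *; omega)
      have e5 : (q ^ (1 - ((M : ℤ) + 1)) - 1) * Fn q k L (M + 1 - 2) (l + 1) =
          (q ^ (1 - ((M : ℤ) + 1)) - 1) * GA k q L (M + 1 - 2) (l + 1) (A - 1) := by
        rcases M with _ | M
        · simp
        · have := ihl (l + 1) (by omega) M (by omega) (by omega) (A - 1) (by push_cast at *; omega)
          push_cast at *
          rw [show (M : ℤ) + 1 + 1 - 2 = M by ring, this]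
      push_cast at *
      simp only [add_sub_cancel_right] at *
      rw [show (l : ℤ) + 1 + 1 = l + 2 by ring] at *
      have : Fn q k L M (l + 2) = GA k q L M (l + 2) A := by
        linear_combination e3 - e1 + e2 - e4 - e5
      exact this
  intro M
  induction M using Nat.strong_induction_on with
  | _ M ihM =>
  intro l hl A hA
  rcases M with _ | M
  · by_cases h : l < L
    · exact c1 l 0 (by omega) hl A hA
    · push_cast at *
      rw [Fn_init h0 h1 k L l (by omega) (by omega) (by omega) ⟨A, by omega⟩,
        GA_init h0 h1 L l A (by omega) (by omega) hl (by omega)]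
  · rcases l with _ | l
    · have e1 := Fn_low h0 h1 k L (M + 1) (by omega) ⟨A, by push_cast at *; omega⟩
      have e2 := GA_zero k q L (M + 1) A
      have e3 := ihM M (by omega) 1 hk A (by push_cast at *; omega)
      simp only [add_sub_cancel_right] at e1 e2
      push_cast at *
      rw [e1, e2, e3]
    · have e1 := Fn_three h0 h1 k L (M + 1) (l + 1) (by omega)
      have e4 := ihM M (by omega) l (by omega) (A - 1) (by push_cast at *; omega)
      have e5 : (q ^ (1 - ((M : ℤ) + 1)) - 1) * Fn q k L (M + 1 - 2) (l + 1) =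
          (q ^ (1 - ((M : ℤ) + 1)) - 1) * GA k q L (M + 1 - 2) (l + 1) (A - 1) := by
        rcases M with _ | M
        · simp
        · have := ihM M (by omega) (l + 1) (by omega) (A - 1) (by push_cast at *; omega)
          push_cast at *
          rw [show (M : ℤ) + 1 + 1 - 2 = M by ring, this]
      rcases Nat.eq_or_lt_of_le hl with h | h
      · have e2 := GA_top h0 h1 (k := k) (L := L) (M := M + 1) (l := l) (A := A) (by omega)
          (by push_cast at *; omega) h
        have e3 := Fn_top (q := q) k L M ⟨A, by push_cast at *; omega⟩
        have hc : (k : ℤ) = l + 1 := by omega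
        rw [hc] at e3
        push_cast at *
        simp only [add_sub_cancel_right] at *
        linear_combination e1 - e2 + e3 + e4 + e5
      · have e2 := GA_three h0 h1 (k := k) (L := L) (M := M + 1) (l := l) (A := A) (by omega)
          (by push_cast at *; omega) h
        have e3 := ihM M (by omega) (l + 2) (by omega) A (by push_cast at *; omega)
        push_cast at *
        simp only [add_sub_cancel_right] at *
        rw [show (l : ℤ) + 1 + 1 = l + 2 by ring] at e1
        linear_combination e1 - e2 + e3 + e4 + e5

/-! ### change of variables -/

theorem sum_nn_id (a : ℕ → ℤ) (h0 : a 0 = 0) (K : ℕ) :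
    ∑ i ∈ Finset.Ico 1 (K + 1), nn a i * (i : ℤ) = (K + 1) * a K - K * a (K + 1) := by
  induction K with
  | zero => simp [h0]
  | succ K ih =>
    rw [Finset.sum_Ico_succ_top (by omega), ih]; unfold nn; simp only [Nat.add_sub_cancel]
    push_cast; ring

theorem sum_nn_min (a : ℕ → ℤ) (h0 : a 0 = 0) (l : ℕ) (K : ℕ) (hl : l ≤ K + 1) :
    ∑ i ∈ Finset.Ico 1 (K + 1), nn a i * min (i : ℤ) l = a l + l * (a K - a (K + 1)) := by
  induction K with
  | zero =>
    rcases Nat.eq_zero_or_pos l with h | h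
    · subst h; simp [h0]
    · have : l = 1 := by omega
      subst this; simp [h0]
  | succ K ih =>
    rcases Nat.eq_or_lt_of_le hl with h | h
    · have : ∀ i ∈ Finset.Ico 1 (K + 1 + 1), nn a i * min (i : ℤ) l = nn a i * (i : ℤ) := by
        intro i hi
        rw [Finset.mem_Ico] at hi
        rw [min_eq_left (by omega)]
      rw [Finset.sum_congr rfl this, sum_nn_id a h0, h]
      push_cast; ring
    · rw [Finset.sum_Ico_succ_top (by omega), ih (by omega), min_eq_right (by omega)]
      unfold nn; simp only [Nat.add_sub_cancel]; ring

def phi (k : ℕ) (a : ℕ → ℤ) : Fin (k - 1) → ℤ := fun j => nn a ((j : ℕ) + 1)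

theorem sum_fin {R : Type*} [AddCommMonoid R] (k : ℕ) (g : ℕ → R) :
    ∑ i : Fin (k - 1), g ((i : ℕ) + 1) = ∑ i ∈ Finset.Ico 1 k, g i := by
  rw [Fin.sum_univ_eq_sum_range (fun j => g (j + 1)), Finset.sum_Ico_eq_sum_range]
  exact Finset.sum_congr rfl fun i _ => by rw [add_comm]

theorem prod_fin {R : Type*} [CommMonoid R] (k : ℕ) (g : ℕ → R) :
    ∏ i : Fin (k - 1), g ((i : ℕ) + 1) = ∏ i ∈ Finset.Ico 1 k, g i := by
  rw [Fin.prod_univ_eq_prod_range (fun j => g (j + 1)), Finset.prod_Ico_eq_prod_range]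
  exact Finset.prod_congr rfl fun i _ => by rw [add_comm]

theorem mvec_phi {k : ℕ} (hk : 1 ≤ k) {A : ℤ} {a : ℕ → ℤ} (ha : Adm k A a) (i : Fin (k - 1)) :
    mvec k (phi k a) i = (a ((i : ℕ) + 1) : ℚ) - (A : ℚ) * ((i : ℕ) + 1) / k := by
  have hi := i.2
  unfold mvec
  have e : ∀ j : Fin (k - 1), cinv k (i : ℕ) (j : ℕ) * (phi k a j : ℚ) =
      ((nn a ((j : ℕ) + 1) * min ((((j : ℕ) + 1 : ℕ)) : ℤ) (((i : ℕ) + 1 : ℕ) : ℤ) : ℤ) : ℚ)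
      - (((i : ℕ) : ℚ) + 1) / k * ((nn a ((j : ℕ) + 1) * (((j : ℕ) + 1 : ℕ) : ℤ) : ℤ) : ℚ) := by
    intro j
    unfold cinv phi
    push_cast
    rw [min_comm]; ring
  rw [Finset.sum_congr rfl fun j _ => e j, Finset.sum_sub_distrib, ← Finset.mul_sum,
    ← Int.cast_sum, ← Int.cast_sum,
    sum_fin k (fun j => nn a j * min (j : ℤ) (((i : ℕ) + 1 : ℕ) : ℤ)),
    sum_fin k (fun j => nn a j * (j : ℤ))]
  obtain ⟨K, rfl⟩ : ∃ K, k = K + 1 := ⟨k - 1, by omega⟩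
  rw [sum_nn_min a ha.1 _ K (by omega), sum_nn_id a ha.1, ha.2 (K + 1) le_rfl]
  push_cast
  have : (K : ℚ) + 1 ≠ 0 := by positivity
  field_simp
  ring

theorem eV_phi (k : ℕ) (l : ℕ) (hl : l ≤ k) : eV k l = phi k (fun i => min (i : ℤ) l) := by
  ext i
  have := i.2
  unfold eV phi nn
  simp only [Nat.add_sub_cancel]
  split_ifs with h <;> push_cast <;> omega

theorem phi_lin (k : ℕ) (a b c : ℕ → ℤ) (x y z : ℤ) :
    x • phi k a + y • phi k b + z • phi k c = phi k (x • a + y • b + z • c) := by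
  ext i
  unfold phi nn
  simp only [Pi.add_apply, Pi.smul_apply, smul_eq_mul]
  ring

theorem qBinQ_int (q : ℝ) (x y : ℤ) : qBinQ q (x : ℚ) (y : ℚ) = qBinI q x y := by
  unfold qBinQ qBinI
  simp

theorem Adm_min (k l : ℕ) (hl : l ≤ k) : Adm k l (fun i : ℕ => min (i : ℤ) l) :=
  ⟨by simp, fun i hi => by show min (i : ℤ) l = l; omega⟩

theorem Adm_lin {k : ℕ} {a b c : ℕ → ℤ} {A B C : ℤ} (x y z : ℤ) (ha : Adm k A a) (hb : Adm k B b)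
    (hc : Adm k C c) : Adm k (x * A + y * B + z * C) (x • a + y • b + z • c) := by
  refine ⟨?_, fun i hi => ?_⟩
  · simp [ha.1, hb.1, hc.1]
  · simp [ha.2 i hi, hb.2 i hi, hc.2 i hi]

theorem quad_phi {k : ℕ} (hk : 1 ≤ k) {M : ℤ} {l : ℕ} (hl : l ≤ k) {A : ℤ}
    {a : ℕ → ℤ} (ha : Adm k A a) :
    quad k (phi k a) (phi k a - M • eV k 1 - eV k l) =
      (QQ k a - M * a 1 - a l : ℤ) - (A : ℚ) * (A - M - l) / k := by
  have hv : phi k a - M • eV k 1 - eV k l = phi k ((1 : ℤ) • a + (-M) • (fun i : ℕ => min (i : ℤ) (1 : ℕ))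
      + (-1 : ℤ) • (fun i : ℕ => min (i : ℤ) l)) := by
    rw [← phi_lin, ← eV_phi k 1 hk, ← eV_phi k l hl]
    simp [sub_eq_add_neg]
  have hadm := Adm_lin 1 (-M) (-1) ha (Adm_min k 1 hk) (Adm_min k l hl)
  have hq : ∀ v, quad k (phi k a) v = ∑ i, (phi k a i : ℚ) * mvec k v i := by
    intro v
    unfold quad mvec
    refine Finset.sum_congr rfl fun i _ => ?_
    rw [Finset.mul_sum]
    exact Finset.sum_congr rfl fun j _ => by ring
  rw [hq, hv]
  have e : ∀ i : Fin (k - 1), (phi k a i : ℚ) * mvec k (phi k ((1 : ℤ) • a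
      + (-M) • (fun i : ℕ => min (i : ℤ) (1 : ℕ)) + (-1 : ℤ) • (fun i : ℕ => min (i : ℤ) l))) i =
      ((nn a ((i : ℕ) + 1) * a ((i : ℕ) + 1) : ℤ) : ℚ) - M * ((nn a ((i : ℕ) + 1) : ℤ) : ℚ)
      - ((nn a ((i : ℕ) + 1) * min ((((i : ℕ) + 1 : ℕ)) : ℤ) l : ℤ) : ℚ)
      - ((A : ℚ) - M - l) / k * ((nn a ((i : ℕ) + 1) * (((i : ℕ) + 1 : ℕ) : ℤ) : ℤ) : ℚ) := by
    intro i
    rw [mvec_phi hk hadm]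
    simp only [Pi.add_apply, Pi.smul_apply, smul_eq_mul]
    rw [show min (((i : ℕ) + 1 : ℕ) : ℤ) (1 : ℕ) = 1 by push_cast; omega]
    unfold phi
    push_cast
    ring
  rw [Finset.sum_congr rfl fun j _ => e j, Finset.sum_sub_distrib, Finset.sum_sub_distrib,
    Finset.sum_sub_distrib, ← Finset.mul_sum, ← Finset.mul_sum,
    ← Int.cast_sum, ← Int.cast_sum, ← Int.cast_sum, ← Int.cast_sum,
    sum_fin k (fun j => nn a j * a j), sum_fin k (fun j => nn a j),
    sum_fin k (fun j => nn a j * min (j : ℤ) l), sum_fin k (fun j => nn a j * (j : ℤ))]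
  obtain ⟨K, rfl⟩ : ∃ K, k = K + 1 := ⟨k - 1, by omega⟩
  rw [sum_nn_min a ha.1 _ K (by omega), sum_nn_id a ha.1, sum_nn_a a ha.1, sum_nn,
    ha.2 (K + 1) le_rfl, ha.1]
  push_cast
  have : (K : ℚ) + 1 ≠ 0 := by positivity
  field_simp
  ring

theorem bin_phi {k : ℕ} (hk : 1 ≤ k) (q : ℝ) {N : ℤ} {l : ℕ} (hl : l ≤ k) {A : ℤ}
    (hA : 2 * A = N + l) {a : ℕ → ℤ} (ha : Adm k A a) (i : Fin (k - 1)) :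
    qBinQ q ((phi k a i : ℚ) + mvec k (N • eV k 1 + eV k l - (2 : ℤ) • phi k a) i) (phi k a i : ℚ)
      = qBinI q (TT N l a ((i : ℕ) + 1)) (nn a ((i : ℕ) + 1)) := by
  have hv : N • eV k 1 + eV k l - (2 : ℤ) • phi k a = phi k ((-2 : ℤ) • a
      + N • (fun i : ℕ => min (i : ℤ) (1 : ℕ)) + (1 : ℤ) • (fun i : ℕ => min (i : ℤ) l)) := by
    rw [← phi_lin, ← eV_phi k 1 hk, ← eV_phi k l hl]
    simp [sub_eq_add_neg]; abel
  have hadm := Adm_lin (-2) N 1 ha (Adm_min k 1 hk) (Adm_min k l hl)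
  rw [hv, mvec_phi hk hadm, ← qBinQ_int]
  have h0 : (((-2 * A + N * (1 : ℕ) + 1 * l : ℤ)) : ℚ) = 0 := by
    rw [show (-2 * A + N * (1 : ℕ) + 1 * l : ℤ) = 0 by push_cast; omega]; simp
  rw [h0]
  simp only [Pi.add_apply, Pi.smul_apply, smul_eq_mul]
  rw [show min (((i : ℕ) + 1 : ℕ) : ℤ) (1 : ℕ) = 1 by push_cast; omega]
  unfold phi
  congr 1
  unfold TT nn
  push_cast
  ring

theorem phi_inj {k : ℕ} (hk : 1 ≤ k) {A : ℤ} {a b : ℕ → ℤ} (ha : Adm k A a) (hb : Adm k A b)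
    (h : phi k a = phi k b) : a = b := by
  have h1 : ∀ i, i + 1 ≤ k → a i - b i = i * (a 1 - b 1) ∧ a (i + 1) - b (i + 1) = (i + 1) * (a 1 - b 1) := by
    intro i
    induction i with
    | zero => intro _; simp [ha.1, hb.1]
    | succ i ih =>
      intro hi
      obtain ⟨e1, e2⟩ := ih (by omega)
      have := congrFun h ⟨i, by omega⟩
      unfold phi nn at this
      simp only [Nat.add_sub_cancel] at this
      refine ⟨by push_cast; exact e2, ?_⟩
      push_cast
      linear_combination 2 * e2 - e1 - this
  have h2 := (h1 (k - 1) (by omega)).2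
  rw [show k - 1 + 1 = k by omega, ha.2 k le_rfl, hb.2 k le_rfl] at h2
  have h3 : a 1 - b 1 = 0 := by
    have : ((k - 1 : ℕ) : ℤ) + 1 ≠ 0 := by omega
    simpa [this] using h2
  ext i
  by_cases hi : i + 1 ≤ k
  · have := (h1 i hi).1
    rw [h3] at this; simp at this; omega
  · rw [ha.2 i (by omega), hb.2 i (by omega)]

theorem phi_surj {k : ℕ} (hk : 1 ≤ k) {A : ℤ} (n : Fin (k - 1) → ℤ)
    (h : (k : ℤ) ∣ A - ∑ i : Fin (k - 1), ((i : ℤ) + 1) * n i) : ∃ a, Adm k A a ∧ phi k a = n := by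
  obtain ⟨c, hc⟩ := h
  let N : ℕ → ℤ := fun j => if h : j < k - 1 then n ⟨j, h⟩ else 0
  have hN : ∀ j : Fin (k - 1), N j = n j := fun j => by simp [N]
  let S1 : ℕ → ℤ := fun i => ∑ j ∈ Finset.range i, N j
  let S2 : ℕ → ℤ := fun i => ∑ j ∈ Finset.range i, ((j : ℤ) + 1) * N j
  have hS1 : ∀ i, S1 (i + 1) = S1 i + N i := fun i => Finset.sum_range_succ _ _
  have hS2 : ∀ i, S2 (i + 1) = S2 i + ((i : ℤ) + 1) * N i := fun i => Finset.sum_range_succ _ _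
  have hNk : N (k - 1) = 0 := by simp [N]
  have hS : S2 (k - 1) = ∑ i : Fin (k - 1), ((i : ℤ) + 1) * n i := by
    show ∑ j ∈ Finset.range (k - 1), ((j : ℤ) + 1) * N j = _
    rw [← Fin.sum_univ_eq_sum_range (fun j => ((j : ℤ) + 1) * N j)]
    exact Finset.sum_congr rfl fun i _ => by rw [hN]
  have hSk : S2 k = S2 (k - 1) := by
    have := hS2 (k - 1)
    rw [show k - 1 + 1 = k by omega, hNk] at this
    linarith
  let b : ℤ := c + S1 k
  let a : ℕ → ℤ := fun i => if i < k then (i : ℤ) * b - i * S1 i + S2 i else A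
  have ha : ∀ i, i ≤ k → a i = (i : ℤ) * b - i * S1 i + S2 i := by
    intro i hi
    rcases Nat.eq_or_lt_of_le hi with h | h
    · subst h
      simp only [a, b, lt_irrefl, if_false]
      rw [hSk, hS]; linarith
    · simp only [a, if_pos h]
  refine ⟨a, ⟨?_, ?_⟩, ?_⟩
  · rw [ha 0 (by omega)]; simp [S2]
  · intro i hi
    simp only [a]; rw [if_neg (by omega)]
  · ext j
    have := j.2
    unfold phi nn
    rw [Nat.add_sub_cancel, ha _ (by omega), ha _ (by omega), ha _ (by omega), hS1, hS1, hS2, hS2, hS1, hS2,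
      ← hN]
    push_cast
    ring

theorem phi_dvd {k : ℕ} (hk : 1 ≤ k) {A : ℤ} {a : ℕ → ℤ} (ha : Adm k A a) :
    (k : ℤ) ∣ A - ∑ i : Fin (k - 1), ((i : ℤ) + 1) * phi k a i := by
  have : ∑ i : Fin (k - 1), ((i : ℤ) + 1) * phi k a i = ∑ i ∈ Finset.Ico 1 k, nn a i * (i : ℤ) := by
    rw [← sum_fin k (fun i => nn a i * (i : ℤ))]
    exact Finset.sum_congr rfl fun i _ => by unfold phi; push_cast; ring
  rw [this]
  obtain ⟨K, rfl⟩ : ∃ K, k = K + 1 := ⟨k - 1, by omega⟩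
  rw [sum_nn_id a ha.1, ha.2 (K + 1) le_rfl]
  exact ⟨A - a K, by push_cast; ring⟩

/-- Proposition 2.2: a fermionic form for a sum of products of
ABF one-dimensional configuration sums. -/
theorem ABF_bilinear_fermionic
    (k : ℕ) (hk : 1 ≤ k) (ℓ : ℤ) (hℓ0 : 0 ≤ ℓ) (hℓk : ℓ ≤ (k : ℤ)) (L M : ℕ)
    (hpar : (2 : ℤ) ∣ ((L : ℤ) + (M : ℤ) + ℓ))
    (q : ℝ) (hq0 : 0 < q) (hq1 : q < 1)
    (f : (Fin (k - 1) → ℤ) → ℝ)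
    (hf : f = fun n =>
      if (2 * (k : ℤ)) ∣ ((L : ℤ) + (M : ℤ) + ℓ - 2 * ∑ i : Fin (k - 1), ((i : ℤ) + 1) * n i) then
        q ^ ((quad k n (n - (M : ℤ) • eV k 1 - eV k ℓ) : ℚ) : ℝ) *
          ∏ i : Fin (k - 1),
            qBinQ q ((n i : ℚ) + mvec k (((L : ℤ) + (M : ℤ)) • eV k 1 + eV k ℓ - (2 : ℤ) • n) i)
              (n i : ℚ)
      else 0) :
    (Function.support f).Finite ∧
    (∑ i ∈ Finset.range (k + 1),
      (if (2 : ℤ) ∣ ((i : ℤ) - (L : ℤ)) then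
        Xcfg q⁻¹ 1 ((k : ℤ) + 2) 1 ((i : ℤ) + 1) (ℓ + 1) (M : ℤ) *
          Xcfg q 1 ((k : ℤ) + 2) 1 ((i : ℤ) + 1) 1 (L : ℤ)
      else 0))
    = q ^ ((((L : ℝ) ^ 2 - ((M : ℝ) + (ℓ : ℝ)) ^ 2) / (4 * (k : ℝ)))
          - ((L : ℝ) - (M : ℝ) - (ℓ : ℝ)) / 2) *
        ∑' n : Fin (k - 1) → ℤ, f n := by
  lift ℓ to ℕ using hℓ0 with l
  have hl : l ≤ k := by omega
  obtain ⟨A, hA⟩ := hpar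
  have hfa : ∀ a, Adm k A a → q ^ ((((L : ℝ) ^ 2 - ((M : ℝ) + ((l : ℤ) : ℝ)) ^ 2) / (4 * (k : ℝ)))
          - ((L : ℝ) - (M : ℝ) - ((l : ℤ) : ℝ)) / 2) * f (phi k a) = Full k q L M l A a := by
    intro a ha
    rw [hf]
    beta_reduce
    have hd : (2 * (k : ℤ)) ∣ ((L : ℤ) + (M : ℤ) + l
        - 2 * ∑ i : Fin (k - 1), ((i : ℤ) + 1) * phi k a i) := by
      rw [hA, ← mul_sub]
      exact mul_dvd_mul_left 2 (phi_dvd hk ha)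
    rw [if_pos hd, quad_phi hk hl ha, Finset.prod_congr rfl fun i _ =>
      bin_phi hk q hl (A := A) (by omega) ha i, prod_fin k (fun i => qBinI q (TT (L + M) l a i) (nn a i))]
    unfold Full gen Br WW
    rw [if_pos ha, ← mul_assoc, ← Real.rpow_add hq0]
    simp only [sub_zero, add_zero]
    congr 1
    rw [← Real.rpow_intCast]
    congr 1
    have hk' : (k : ℝ) ≠ 0 := by positivity
    have hA' : (L : ℝ) + M + l = 2 * A := by exact_mod_cast hA
    have hA2 : (A : ℝ) = (L + M + l) / 2 := by linarith
    push_cast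
    rw [hA2]
    field_simp
    ring
  have hsurj : ∀ n, f n ≠ 0 → ∃ a, Adm k A a ∧ phi k a = n := by
    intro n hn
    rw [hf] at hn
    beta_reduce at hn
    split_ifs at hn with h
    · rw [hA, ← mul_sub] at h
      exact phi_surj hk n (Int.dvd_of_mul_dvd_mul_left (by norm_num) h)
    · exact absurd rfl hn
  refine ⟨?_, ?_⟩
  · refine ((box_finite k (L + M) l A).image (phi k)).subset ?_
    intro n hn
    obtain ⟨a, ha, rfl⟩ := hsurj n hn
    refine ⟨a, ?_, rfl⟩
    have h1 : Full k q L M l A a ≠ 0 := by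
      rw [← hfa a ha]
      exact mul_ne_zero (Real.rpow_pos_of_pos hq0 _).ne' hn
    exact gen_supp (fun _ => le_rfl) (fun _ => le_rfl) h1
  · have h1 := Fn_GA hk L q hq0 hq1.ne M l hl A (by omega)
    unfold Fn at h1
    rw [h1, ← tsum_mul_left]
    unfold GA
    have hinj : Function.Injective (fun a : {a | Adm k A a} => phi k a) :=
      fun a b hab => Subtype.ext (phi_inj hk a.2 b.2 hab)
    rw [← hinj.tsum_eq]
    · rw [← tsum_subtype_eq_of_support_subset (s := {a | Adm k A a})]
      · exact tsum_congr fun a => (hfa a a.2).symm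
      · intro a ha
        exact (gen_supp (fun _ => le_rfl) (fun _ => le_rfl) ha).1
    · intro n hn
      obtain ⟨a, ha, rfl⟩ := hsurj n (right_ne_zero_of_mul hn)
      exact ⟨⟨a, ha⟩, rfl⟩
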